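/- Let Λ ⊆ ℤ^d be finite and connected, a > 0, p > 0, r > 0, κ > 0, and Z : Λ → ℝ^m. Then ∫ over the set {X : Λ → ℝ^m : Σ_{i∈Λ}|X(i)−Z(i)|^r < κ^r |Λ|^{1+r/d}} of exp(−a Σ over nearest-neighbour edges of Λ of |X(i)−X(j)|^p) Π dX(i) is at most ω(m) κ^m |Λ|^{1+m/d} (a^{−m/p} c(p,m))^{|Λ|−1}. -/

import Mathlib

open scoped BigOperators
open MeasureTheory

/-- In a connected graph, every vertex other than the root has a neighbour nearer to the root. -/
lemma SimpleGraph.Connected.exists_adj_dist_lt {V : Type*} {G : SimpleGraph V} (hG : G.Connected)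
    {j v : V} (hv : v ≠ j) : ∃ u, G.Adj v u ∧ G.dist u j < G.dist v j := by
  obtain ⟨w, hw⟩ := hG.exists_walk_length_eq_dist v j
  cases w with
  | nil => exact absurd rfl hv
  | cons h q =>
    refine ⟨_, h, ?_⟩
    have := SimpleGraph.dist_le q
    simp only [SimpleGraph.Walk.length_cons] at hw
    omega

/-- An integer vector of `ℓ¹`-norm one is plus or minus a standard basis vector. -/
lemma exists_eq_single_of_sum_abs_eq_one {ι : Type*} [Fintype ι] [DecidableEq ι] {w : ι → ℤ}
    (hw : ∑ k, |w k| = 1) : ∃ k, w = Pi.single k 1 ∨ w = -Pi.single k 1 := by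
  obtain ⟨k, hk⟩ : ∃ k, w k ≠ 0 := by
    by_contra! h
    simp [h] at hw
  have hsum := Finset.add_sum_erase Finset.univ (fun l => |w l|) (Finset.mem_univ k)
  have hk1 : 1 ≤ |w k| := Int.one_le_abs hk
  have hnonneg : 0 ≤ ∑ l ∈ Finset.univ.erase k, |w l| := Finset.sum_nonneg fun _ _ => abs_nonneg _
  have hrest : ∀ l, l ≠ k → w l = 0 := fun l hl => by
    have h0 : ∑ l ∈ Finset.univ.erase k, |w l| = 0 := by omega
    rw [Finset.sum_eq_zero_iff_of_nonneg fun _ _ => abs_nonneg _] at h0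
    exact abs_eq_zero.mp (h0 l (by simp [hl]))
  have habs : |w k| = 1 := by omega
  refine ⟨k, ?_⟩
  rcases eq_or_eq_neg_of_abs_eq habs with h | h
  · left
    funext l
    rcases eq_or_ne l k with rfl | hl
    · simp [h]
    · simp [hl, hrest l hl]
  · right
    funext l
    rcases eq_or_ne l k with rfl | hl
    · simp [h]
    · simp [hl, hrest l hl]

/-- The non-root vertices of a rooted tree, given by its parent map `π`, can be integrated out
leaf by leaf. -/
lemma lmarginal_mul_prod_parent {V E : Type*} [DecidableEq V]
    [AddGroup E] [MeasurableSpace E] [MeasurableAdd₂ E] [MeasurableSub₂ E] (μ : Measure E)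
    [SigmaFinite μ] [μ.IsAddRightInvariant] {g φ : E → ENNReal} (hg : Measurable g)
    (hφ : Measurable φ) (j : V) (π : V → V) (depth : V → ℕ)
    (hπ : ∀ v, v ≠ j → depth (π v) < depth v) (s : Finset V) (hs : j ∉ s) :
    lmarginal (fun _ => μ) s (fun X => g (X j) * ∏ v ∈ s, φ (X v - X (π v))) =
      fun X => g (X j) * (∫⁻ ξ, φ ξ ∂μ) ^ s.card := by
  induction s using Finset.induction_on_max_value depth generalizing g with
  | empty => simp
  | insert i s hi hmax ih =>
    have hji : j ≠ i := fun h => hs (by simp [h])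
    have hjs : j ∉ s := fun h => hs (by simp [h])
    have hmeas : ∀ t : Finset V,
        Measurable fun X : V → E => g (X j) * ∏ v ∈ t, φ (X v - X (π v)) := fun t => by
      fun_prop
    rw [lmarginal_insert' _ (hmeas _) hi]
    have hinner : (fun X : V → E => ∫⁻ ξ, g (Function.update X i ξ j) *
          ∏ v ∈ insert i s, φ (Function.update X i ξ v - Function.update X i ξ (π v)) ∂μ) =
        fun X => (∫⁻ ξ, φ ξ ∂μ) * g (X j) * ∏ v ∈ s, φ (X v - X (π v)) := by
      funext X
      have hπi : π i ≠ i := fun h => by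
        have := hπ i hji.symm
        rw [h] at this
        exact lt_irrefl _ this
      have hprod : ∀ ξ, ∏ v ∈ s, φ (Function.update X i ξ v - Function.update X i ξ (π v)) =
          ∏ v ∈ s, φ (X v - X (π v)) := fun ξ => by
        refine Finset.prod_congr rfl fun v hv => ?_
        have h1 : v ≠ i := fun h => hi (h ▸ hv)
        have h2 : π v ≠ i := fun h => by
          have := hπ v fun h => hjs (h ▸ hv)
          rw [h] at this
          exact absurd (hmax v hv) (by omega)
        simp [h1, h2]
      simp_rw [Finset.prod_insert hi, hprod, Function.update_self, Function.update_of_ne hji,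
        Function.update_of_ne hπi]
      calc _ = ∫⁻ ξ, φ (ξ - X (π i)) * (g (X j) * ∏ v ∈ s, φ (X v - X (π v))) ∂μ := by
            congr 1 with ξ
            ring
        _ = _ := by
            rw [lintegral_mul_const _ (by fun_prop), lintegral_sub_right_eq_self, mul_assoc]
    rw [hinner, ih (hg.const_mul _) hjs, Finset.card_insert_of_notMem hi]
    funext X
    ring

/-- Integral of a product of functions of differences along the edges of a rooted spanning tree. -/
lemma lintegral_mul_prod_parent {V E : Type*} [Fintype V] [DecidableEq V]
    [AddGroup E] [MeasurableSpace E] [MeasurableAdd₂ E] [MeasurableSub₂ E] (μ : Measure E)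
    [SigmaFinite μ] [μ.IsAddRightInvariant] {g φ : E → ENNReal} (hg : Measurable g)
    (hφ : Measurable φ) (j : V) (π : V → V) (depth : V → ℕ)
    (hπ : ∀ v, v ≠ j → depth (π v) < depth v) :
    ∫⁻ X : V → E, g (X j) * ∏ v ∈ Finset.univ.erase j, φ (X v - X (π v))
        ∂(Measure.pi fun _ => μ) =
      (∫⁻ ξ, g ξ ∂μ) * (∫⁻ ξ, φ ξ ∂μ) ^ (Fintype.card V - 1) := by
  have hmeas : Measurable fun X : V → E =>
      g (X j) * ∏ v ∈ Finset.univ.erase j, φ (X v - X (π v)) := by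
    fun_prop
  have h := congrFun (lmarginal_univ (μ := fun _ : V => μ)
    (f := fun X => g (X j) * ∏ v ∈ Finset.univ.erase j, φ (X v - X (π v)))) (fun _ => (0 : E))
  rw [← h, ← Finset.insert_erase (Finset.mem_univ j)]
  simp only [Finset.erase_insert_eq_erase, Finset.erase_idem]
  rw [lmarginal_insert _ hmeas (by simp),
    lmarginal_mul_prod_parent μ hg hφ j π depth hπ _ (by simp)]
  simp [lintegral_mul_const _ hg, Finset.card_erase_of_mem]

/-- The function `exp (-|ξ|^p)` is integrable on `ℝ^m` for every `p > 0`. -/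
lemma integrable_exp_neg_norm_rpow (m : ℕ) (hm : 0 < m) {p : ℝ} (hp : 0 < p) :
    Integrable fun ξ : EuclideanSpace ℝ (Fin m) => Real.exp (-‖ξ‖ ^ p) := by
  have : Nonempty (Fin m) := ⟨⟨0, hm⟩⟩
  rw [integrable_fun_norm_addHaar (μ := (volume : Measure (EuclideanSpace ℝ (Fin m))))
    (f := fun y => Real.exp (-y ^ p))]
  have hq : (-1 : ℝ) < (m - 1 : ℕ) := by
    have : (0 : ℝ) ≤ (m - 1 : ℕ) := Nat.cast_nonneg _
    linarith
  refine Integrable.of_integral_ne_zero ?_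
  have h := integral_rpow_mul_exp_neg_rpow hp hq
  simp only [Real.rpow_natCast] at h
  simp only [finrank_euclideanSpace_fin, smul_eq_mul]
  rw [h]
  have : 0 < Real.Gamma ((((m - 1 : ℕ) : ℝ) + 1) / p) := Real.Gamma_pos_of_pos (by positivity)
  positivity

/-- Scaling `exp (-a|ξ|^p)` to `a = 1` produces the factor `a^{-m/p}`. -/
lemma lintegral_exp_neg_mul_norm_rpow (m : ℕ) (hm : 0 < m) {a p : ℝ} (ha : 0 < a) (hp : 0 < p) :
    ∫⁻ ξ : EuclideanSpace ℝ (Fin m), ENNReal.ofReal (Real.exp (-(a * ‖ξ‖ ^ p))) =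
      ENNReal.ofReal (a ^ (-(m : ℝ) / p) *
        ∫ ξ : EuclideanSpace ℝ (Fin m), Real.exp (-‖ξ‖ ^ p)) := by
  have hc : 0 < a ^ (1 / p) := by positivity
  have hscale : (fun ξ : EuclideanSpace ℝ (Fin m) => Real.exp (-(a * ‖ξ‖ ^ p))) =
      fun ξ => Real.exp (-‖a ^ (1 / p) • ξ‖ ^ p) := by
    funext ξ
    rw [norm_smul, Real.norm_of_nonneg hc.le, Real.mul_rpow hc.le (norm_nonneg _),
      ← Real.rpow_mul ha.le, one_div_mul_cancel hp.ne', Real.rpow_one]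
  have hint : Integrable fun ξ : EuclideanSpace ℝ (Fin m) => Real.exp (-(a * ‖ξ‖ ^ p)) := by
    rw [hscale]
    exact (integrable_exp_neg_norm_rpow m hm hp).comp_smul hc.ne'
  rw [← ofReal_integral_eq_lintegral_ofReal hint (.of_forall fun _ => (Real.exp_pos _).le), hscale,
    Measure.integral_comp_smul volume (fun ξ : EuclideanSpace ℝ (Fin m) => Real.exp (-‖ξ‖ ^ p))]
  congr 2
  rw [finrank_euclideanSpace_fin, abs_of_pos (by positivity), ← Real.rpow_natCast,
    ← Real.rpow_mul ha.le, ← Real.rpow_neg ha.le]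
  congr 1
  ring

/-- The discrete gradient energy dominates the energy of any rooted spanning tree. -/
lemma sum_parent_le_gradient_energy {d : ℕ} {E : Type*} [SeminormedAddCommGroup E] (hd : 0 < d)
    (Λ : Finset (Fin d → ℤ)) (p : ℝ) (j : ↥Λ) (π : ↥Λ → ↥Λ) (depth : ↥Λ → ℕ)
    (hπ : ∀ v, v ≠ j → depth (π v) < depth v)
    (hadj : ∀ v, v ≠ j → ∑ k, |(v : Fin d → ℤ) k - (π v : Fin d → ℤ) k| = 1) (X : ↥Λ → E) :
    ∑ v ∈ Finset.univ.erase j, ‖X v - X (π v)‖ ^ p ≤ ∑ i : ↥Λ, ∑ k : Fin d,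
      (if h : ((i : Fin d → ℤ) + Pi.single k 1) ∈ Λ
        then ‖X ⟨(i : Fin d → ℤ) + Pi.single k 1, h⟩ - X i‖ ^ p else 0) := by
  have : Nonempty (↥Λ × Fin d) := ⟨(j, ⟨0, hd⟩)⟩
  have hedge : ∀ v, v ≠ j → ∃ q : ↥Λ × Fin d,
      (q.1 = v ∧ (q.1 : Fin d → ℤ) + Pi.single q.2 1 = (π v : Fin d → ℤ)) ∨
        (q.1 = π v ∧ (q.1 : Fin d → ℤ) + Pi.single q.2 1 = (v : Fin d → ℤ)) := fun v hv => by
    obtain ⟨k, hk | hk⟩ := exists_eq_single_of_sum_abs_eq_one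
      (w := (v : Fin d → ℤ) - (π v : Fin d → ℤ)) (by simpa using hadj v hv)
    · exact ⟨(π v, k), .inr ⟨rfl, (sub_eq_iff_eq_add'.mp hk).symm⟩⟩
    · rw [← neg_eq_iff_eq_neg, neg_sub] at hk
      exact ⟨(v, k), .inl ⟨rfl, (sub_eq_iff_eq_add'.mp hk).symm⟩⟩
  choose! e he using hedge
  set T : ↥Λ × Fin d → ℝ := fun q =>
    if h : ((q.1 : Fin d → ℤ) + Pi.single q.2 1) ∈ Λ
      then ‖X ⟨(q.1 : Fin d → ℤ) + Pi.single q.2 1, h⟩ - X q.1‖ ^ p else 0 with hT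
  have hT_nonneg : ∀ q, 0 ≤ T q := fun q => by
    simp only [hT]
    split_ifs
    · positivity
    · exact le_rfl
  have hT_edge : ∀ v, v ≠ j → T (e v) = ‖X v - X (π v)‖ ^ p := fun v hv => by
    have hval : ∀ (q : ↥Λ × Fin d) (u : ↥Λ),
        (q.1 : Fin d → ℤ) + Pi.single q.2 1 = (u : Fin d → ℤ) →
        T q = ‖X u - X q.1‖ ^ p := fun q u hu => by
      have hmem : (q.1 : Fin d → ℤ) + Pi.single q.2 1 ∈ Λ := hu ▸ u.2
      simp only [hT, dif_pos hmem]
      congr 5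
    rcases he v hv with ⟨h1, h2⟩ | ⟨h1, h2⟩
    · rw [hval _ _ h2, h1, norm_sub_rev]
    · rw [hval _ _ h2, h1]
  have hinj : Set.InjOn e (Finset.univ.erase j : Finset ↥Λ) := fun v hv u hu hvu => by
    have hv : v ≠ j := by simpa using hv
    have hu : u ≠ j := by simpa using hu
    have hv' := he v hv
    have hu' := he u hu
    rw [← hvu] at hu'
    have dv := hπ v hv
    have du := hπ u hu
    rcases hv' with ⟨a1, a2⟩ | ⟨a1, a2⟩ <;> rcases hu' with ⟨b1, b2⟩ | ⟨b1, b2⟩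
    · exact a1.symm.trans b1
    · have h1 : v = π u := a1.symm.trans b1
      have h2 : π v = u := Subtype.ext (a2.symm.trans b2)
      rw [← h1] at du
      rw [h2] at dv
      omega
    · have h1 : π v = u := a1.symm.trans b1
      have h2 : v = π u := Subtype.ext (a2.symm.trans b2)
      rw [← h2] at du
      rw [h1] at dv
      omega
    · exact Subtype.ext (a2.symm.trans b2)
  calc ∑ v ∈ Finset.univ.erase j, ‖X v - X (π v)‖ ^ p
      = ∑ v ∈ Finset.univ.erase j, T (e v) :=
        Finset.sum_congr rfl fun v hv => (hT_edge v (Finset.ne_of_mem_erase hv)).symm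
    _ = ∑ q ∈ (Finset.univ.erase j).image e, T q := (Finset.sum_image hinj).symm
    _ ≤ ∑ q, T q :=
        Finset.sum_le_sum_of_subset_of_nonneg (Finset.subset_univ _) fun q _ _ => hT_nonneg q
    _ = _ := Fintype.sum_prod_type T

/-- Pigeonhole: a small `ℓ^r` distance forces some coordinate to be close. -/
lemma exists_norm_lt_of_sum_rpow_lt {ι E : Type*} [Fintype ι] [SeminormedAddCommGroup E]
    {r s κ : ℝ} (hr : 0 < r) (hκ : 0 < κ) (hι : 0 < Fintype.card ι) {Y : ι → E}
    (hY : ∑ i, ‖Y i‖ ^ r < κ ^ r * (Fintype.card ι : ℝ) ^ (1 + r / s)) :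
    ∃ j, ‖Y j‖ < κ * (Fintype.card ι : ℝ) ^ (1 / s) := by
  by_contra! h
  have hN : (0 : ℝ) < Fintype.card ι := by exact_mod_cast hι
  refine absurd hY (not_lt.mpr ?_)
  calc κ ^ r * (Fintype.card ι : ℝ) ^ (1 + r / s)
      = ∑ _i : ι, (κ * (Fintype.card ι : ℝ) ^ (1 / s)) ^ r := by
        rw [Real.mul_rpow hκ.le (by positivity), ← Real.rpow_mul hN.le, Real.rpow_add hN,
          Real.rpow_one, Finset.sum_const, Finset.card_univ, nsmul_eq_mul, one_div_mul_eq_div]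
        ring
    _ ≤ ∑ i, ‖Y i‖ ^ r := by
        gcongr with i
        exact h i

/-- The Boltzmann factor integrated over configurations with one coordinate clamped to a ball. -/
lemma lintegral_gradient_clamped_le {d m : ℕ} (hd : 0 < d) (hm : 0 < m)
    (Λ : Finset (Fin d → ℤ))
    (hconn : (SimpleGraph.fromRel
      (fun u v : ↥Λ => ∑ k, |(u : Fin d → ℤ) k - (v : Fin d → ℤ) k| = 1)).Connected)
    {a p : ℝ} (ha : 0 < a) (hp : 0 < p) (j : ↥Λ) (z : EuclideanSpace ℝ (Fin m)) (ρ : ℝ) :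
    ∫⁻ X : ↥Λ → EuclideanSpace ℝ (Fin m) in {X | ‖X j - z‖ < ρ},
      ENNReal.ofReal (Real.exp (-(a * ∑ i : ↥Λ, ∑ k : Fin d,
        (if h : ((i : Fin d → ℤ) + Pi.single k 1) ∈ Λ
          then ‖X ⟨(i : Fin d → ℤ) + Pi.single k 1, h⟩ - X i‖ ^ p else 0))))
    ≤ volume (Metric.ball z ρ) *
        ENNReal.ofReal (a ^ (-(m : ℝ) / p) *
          ∫ ξ : EuclideanSpace ℝ (Fin m), Real.exp (-‖ξ‖ ^ p)) ^ (Λ.card - 1) := by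
  classical
  choose! π hπadj hπ using fun v (hv : v ≠ j) => hconn.exists_adj_dist_lt hv
  have hadj : ∀ v, v ≠ j → ∑ k, |(v : Fin d → ℤ) k - (π v : Fin d → ℤ) k| = 1 := fun v hv => by
    rcases ((SimpleGraph.fromRel_adj _ _ _).mp (hπadj v hv)).2 with h | h
    · exact h
    · simpa only [abs_sub_comm] using h
  have htree := lintegral_mul_prod_parent (volume : Measure (EuclideanSpace ℝ (Fin m)))
    (g := (Metric.ball z ρ).indicator 1)
    (φ := fun ξ => ENNReal.ofReal (Real.exp (-(a * ‖ξ‖ ^ p))))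
    (measurable_one.indicator measurableSet_ball) (by fun_prop) j π (SimpleGraph.dist _ · j) hπ
  rw [lintegral_indicator_one measurableSet_ball, lintegral_exp_neg_mul_norm_rpow m hm ha hp,
    Fintype.card_coe] at htree
  have hset : MeasurableSet {X : ↥Λ → EuclideanSpace ℝ (Fin m) | ‖X j - z‖ < ρ} :=
    measurableSet_lt (by fun_prop) measurable_const
  rw [← htree, ← lintegral_indicator hset]
  refine lintegral_mono fun X => ?_
  by_cases hX : ‖X j - z‖ < ρ
  · have hXball : X j ∈ Metric.ball z ρ := by rwa [mem_ball_iff_norm]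
    rw [Set.indicator_of_mem (show X ∈ {X : ↥Λ → EuclideanSpace ℝ (Fin m) | ‖X j - z‖ < ρ}
        from hX), Set.indicator_of_mem hXball, Pi.one_apply, one_mul,
      ← ENNReal.ofReal_prod_of_nonneg fun _ _ => (Real.exp_pos _).le, ← Real.exp_sum,
      Finset.sum_neg_distrib, ← Finset.mul_sum]
    gcongr
    exact sum_parent_le_gradient_energy hd Λ p j π (SimpleGraph.dist _ · j) hπ hadj X
  · rw [Set.indicator_of_notMem (show X ∉ {X : ↥Λ → EuclideanSpace ℝ (Fin m) | ‖X j - z‖ < ρ}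
      from hX)]
    exact zero_le

/-- Lemma A.1(b): for a connected finite `Λ ⊆ ℤ^d`, the integral of the discrete gradient
Boltzmann factor over the `ℓ^r`-neighbourhood of `Z` of radius `κ|Λ|^{1/r+1/d}` is at most
`ω(m) κ^m |Λ|^{1+m/d} (a^{-m/p} c(p,m))^{|Λ|-1}`. -/
theorem stmt_5 (d m : ℕ) (hd : 0 < d) (hm : 0 < m)
    (Λ : Finset (Fin d → ℤ))
    (hconn : (SimpleGraph.fromRel
      (fun u v : ↥Λ => ∑ k, |(u : Fin d → ℤ) k - (v : Fin d → ℤ) k| = 1)).Connected)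
    (a p r κ : ℝ) (ha : 0 < a) (hp : 0 < p) (hr : 0 < r) (hκ : 0 < κ)
    (Z : ↥Λ → EuclideanSpace ℝ (Fin m)) :
    ∫ X : ↥Λ → EuclideanSpace ℝ (Fin m) in
      {X : ↥Λ → EuclideanSpace ℝ (Fin m) |
        ∑ i : ↥Λ, ‖X i - Z i‖ ^ r < κ ^ r * (Λ.card : ℝ) ^ (1 + r / d)},
      Real.exp (-(a * ∑ i : ↥Λ, ∑ k : Fin d,
        (if h : ((i : Fin d → ℤ) + Pi.single k 1) ∈ Λ
          then ‖X ⟨(i : Fin d → ℤ) + Pi.single k 1, h⟩ - X i‖ ^ p else 0)))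
    ≤ (volume (Metric.ball (0 : EuclideanSpace ℝ (Fin m)) 1)).toReal * κ ^ m *
        (Λ.card : ℝ) ^ (1 + (m : ℝ) / d) *
        (a ^ (-(m : ℝ) / p) *
          ∫ ξ : EuclideanSpace ℝ (Fin m), Real.exp (-‖ξ‖ ^ p)) ^ (Λ.card - 1) := by
  have : Nonempty (Fin m) := ⟨⟨0, hm⟩⟩
  have hN : 0 < Λ.card := by
    have := hconn.nonempty
    simpa using Fintype.card_pos (α := ↥Λ)
  have hN' : (0 : ℝ) < Λ.card := by exact_mod_cast hN
  set ρ : ℝ := κ * (Λ.card : ℝ) ^ (1 / (d : ℝ)) with hρ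
  set C : ℝ := a ^ (-(m : ℝ) / p) *
    ∫ ξ : EuclideanSpace ℝ (Fin m), Real.exp (-‖ξ‖ ^ p) with hC
  have hρ0 : 0 ≤ ρ := by positivity
  have hC0 : 0 ≤ C := mul_nonneg (by positivity) (integral_nonneg fun _ => (Real.exp_pos _).le)
  have hcover : {X : ↥Λ → EuclideanSpace ℝ (Fin m) |
      ∑ i : ↥Λ, ‖X i - Z i‖ ^ r < κ ^ r * (Λ.card : ℝ) ^ (1 + r / d)} ⊆
        ⋃ j, {X | ‖X j - Z j‖ < ρ} := fun X hX => by
    have := exists_norm_lt_of_sum_rpow_lt (s := d) hr hκ (by simpa using hN)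
      (Y := fun i => X i - Z i) (by simpa using hX)
    simpa [hρ] using this
  refine (Real.le_norm_self _).trans ((norm_integral_le_lintegral_norm _).trans ?_)
  simp_rw [Real.norm_of_nonneg (Real.exp_pos _).le]
  refine ENNReal.toReal_le_of_le_ofReal (by positivity) ?_
  calc _ ≤ _ := lintegral_mono_set hcover
    _ ≤ _ := lintegral_iUnion_le _ _
    _ ≤ ∑' j : ↥Λ, volume (Metric.ball (Z j) ρ) * ENNReal.ofReal C ^ (Λ.card - 1) :=
        ENNReal.tsum_le_tsum fun j => lintegral_gradient_clamped_le hd hm Λ hconn ha hp j (Z j) ρ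
    _ = _ := by
        simp_rw [Measure.addHaar_ball volume _ hρ0]
        have hω : volume (Metric.ball (0 : EuclideanSpace ℝ (Fin m)) 1) ≠ ⊤ :=
          measure_ball_lt_top.ne
        rw [tsum_fintype, Finset.sum_const, Finset.card_univ, Fintype.card_coe, nsmul_eq_mul,
          finrank_euclideanSpace_fin, ← ENNReal.ofReal_pow hC0, ← ENNReal.ofReal_toReal hω,
          ← ENNReal.ofReal_natCast, ← ENNReal.ofReal_mul (by positivity),
          ← ENNReal.ofReal_mul (by positivity), ← ENNReal.ofReal_mul (by positivity),
          ENNReal.toReal_ofReal ENNReal.toReal_nonneg]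
        congr 1
        rw [hρ, mul_pow, ← Real.rpow_mul_natCast hN'.le, Real.rpow_add hN', Real.rpow_one,
          one_div_mul_eq_div]
        ring
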